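/- For every integer p ≥ 3, B(p,3) is isomorphic to the group presented by generators u, v, w and A_{1,i}, A_{2,i} for 2 ≤ i ≤ p−1, with relators: (i) [w⁻¹ A_{1,i} v, A_{1,j}] for 2 ≤ i < j ≤ p−1; (ii) [w⁻¹ A_{1,i} v, A_{2,j}] for 2 ≤ i ≤ p−2 and 2 ≤ j ≤ p−i; (iii) [v A_{2,j} u, A_{2,i}] for 2 ≤ i < j ≤ p−1; (iv) [v A_{2,j} u, A_{1,i}] for i,j ∈ {3,…,p−1} with i+j ≥ p+2. Here [x,y] denotes the commutator x y x⁻¹ y⁻¹. -/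

import Mathlib

/-- Generators of the presentation of `B(p,q)`: triples `(t, ℓ, i)` with `t ∈ Fin 3`
(`t = 0` for `a`, `t = 1` for `b`, `t = 2` for `c`), `1 ≤ ℓ ≤ q - 1`, `1 ≤ i ≤ p - 1`. -/
def BGen (p q : ℕ) : Type :=
  {x : Fin 3 × ℕ × ℕ // 1 ≤ x.2.1 ∧ x.2.1 ≤ q - 1 ∧ 1 ≤ x.2.2 ∧ x.2.2 ≤ p - 1}

/-- The generator `a_{ℓ,i}` (as an element of the free group), or `1` if out of range. -/
def ga (p q ℓ i : ℕ) : FreeGroup (BGen p q) :=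
  if h : 1 ≤ ℓ ∧ ℓ ≤ q - 1 ∧ 1 ≤ i ∧ i ≤ p - 1 then FreeGroup.of ⟨(0, ℓ, i), h⟩ else 1

/-- The generator `b_{ℓ,i}`, or `1` if out of range. -/
def gb (p q ℓ i : ℕ) : FreeGroup (BGen p q) :=
  if h : 1 ≤ ℓ ∧ ℓ ≤ q - 1 ∧ 1 ≤ i ∧ i ≤ p - 1 then FreeGroup.of ⟨(1, ℓ, i), h⟩ else 1

/-- The generator `c_{ℓ,i}`, or `1` if out of range. -/
def gc (p q ℓ i : ℕ) : FreeGroup (BGen p q) :=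
  if h : 1 ≤ ℓ ∧ ℓ ≤ q - 1 ∧ 1 ≤ i ∧ i ≤ p - 1 then FreeGroup.of ⟨(2, ℓ, i), h⟩ else 1

/-- The commutator `[x, y] = x * y * x⁻¹ * y⁻¹`. -/
def gcomm {G : Type*} [Group G] (x y : G) : G := x * y * x⁻¹ * y⁻¹

/-- The relators (R1)–(R5) of the presentation of `B(p,q)`. -/
def Brels (p q : ℕ) : Set (FreeGroup (BGen p q)) :=
  {r | r = ga p q 1 1 ∨ r = gc p q (q - 1) 1
    ∨ (∃ ℓ i j, 1 ≤ ℓ ∧ ℓ ≤ q - 1 ∧ 1 ≤ i ∧ i < j ∧ j ≤ p - 1 ∧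
        r = gb p q ℓ i * ga p q ℓ j * (gb p q ℓ i)⁻¹ * (gc p q ℓ j)⁻¹)
    ∨ (∃ ℓ i j, 1 ≤ ℓ ∧ ℓ ≤ q - 2 ∧ 1 ≤ i ∧ i ≤ p - 1 ∧ 1 ≤ j ∧ j ≤ p - i ∧
        r = gc p q ℓ i * ga p q (ℓ + 1) j * (gb p q ℓ i)⁻¹ * (gb p q (ℓ + 1) j)⁻¹)
    ∨ (∃ ℓ i j, 1 ≤ ℓ ∧ ℓ ≤ q - 2 ∧ 3 ≤ i ∧ i ≤ p - 1 ∧ 3 ≤ j ∧ j ≤ p - 1 ∧ p + 2 ≤ i + j ∧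
        r = gcomm (gc p q ℓ i) (ga p q (ℓ + 1) j))
    ∨ (∃ ℓ lam i j, 2 ≤ ℓ + 1 ∧ ℓ + 1 < lam ∧ lam ≤ q - 1 ∧
        1 ≤ i ∧ i ≤ p - 1 ∧ 1 ≤ j ∧ j ≤ p - 1 ∧
        r = gcomm (gc p q ℓ i) (ga p q lam j))}

/-- The square-section braid group `B(p,q) = B_{pq-2}(p × q)`, via its presentation. -/
abbrev B (p q : ℕ) : Type := PresentedGroup (Brels p q)

/-- Generators of the presentation of `B(p,3)` from the paper's Section 5:
`Sum.inl 0 = u`, `Sum.inl 1 = v`, `Sum.inl 2 = w`, and `Sum.inr ⟨(k, i), _⟩ = A_{k+1,i}`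
for `k ∈ Fin 2` and `2 ≤ i ≤ p - 1`. -/
def GGen (p : ℕ) : Type :=
  Fin 3 ⊕ {x : Fin 2 × ℕ // 2 ≤ x.2 ∧ x.2 ≤ p - 1}

/-- The generator `u`. -/
def gu (p : ℕ) : FreeGroup (GGen p) := FreeGroup.of (Sum.inl 0)
/-- The generator `v`. -/
def gv (p : ℕ) : FreeGroup (GGen p) := FreeGroup.of (Sum.inl 1)
/-- The generator `w`. -/
def gw (p : ℕ) : FreeGroup (GGen p) := FreeGroup.of (Sum.inl 2)

/-- The generator `A_{1,i}`, with the convention that out-of-range indices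
(in particular `A_{1,p}`) give `1`. -/
def gA1 (p i : ℕ) : FreeGroup (GGen p) :=
  if h : 2 ≤ i ∧ i ≤ p - 1 then FreeGroup.of (Sum.inr ⟨(0, i), h⟩) else 1

/-- The generator `A_{2,i}`, with the convention that out-of-range indices
(in particular `A_{2,1}`) give `1`. -/
def gA2 (p i : ℕ) : FreeGroup (GGen p) :=
  if h : 2 ≤ i ∧ i ≤ p - 1 then FreeGroup.of (Sum.inr ⟨(1, i), h⟩) else 1

/-- The relators of the presentation of `B(p,3)` by generators `u, v, w, A_{1,i}, A_{2,i}`. -/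
def Grels (p : ℕ) : Set (FreeGroup (GGen p)) :=
  {r | (∃ i j, 2 ≤ i ∧ i < j ∧ j ≤ p - 1 ∧
        r = gcomm ((gw p)⁻¹ * gA1 p i * gv p) (gA1 p j))
    ∨ (∃ i j, 2 ≤ i ∧ i ≤ p - 2 ∧ 2 ≤ j ∧ j ≤ p - i ∧
        r = gcomm ((gw p)⁻¹ * gA1 p i * gv p) (gA2 p j))
    ∨ (∃ i j, 2 ≤ i ∧ i < j ∧ j ≤ p - 1 ∧
        r = gcomm (gv p * gA2 p j * gu p) (gA2 p i))
    ∨ (∃ i j, 3 ≤ i ∧ i ≤ p - 1 ∧ 3 ≤ j ∧ j ≤ p - 1 ∧ p + 2 ≤ i + j ∧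
        r = gcomm (gv p * gA2 p j * gu p) (gA1 p i))}

section CommutatorPresentation

variable {H : Type*} [Group H]

theorem gcomm_eq_one_iff (x y : H) : gcomm x y = 1 ↔ x * y = y * x := by
  rw [gcomm, mul_inv_eq_one, mul_inv_eq_iff_eq_mul]

theorem map_gcomm {K : Type*} [Group K] (f : H →* K) (x y : H) :
    f (gcomm x y) = gcomm (f x) (f y) := by
  simp [gcomm]

/-- The images of the generators `a`, `b`, `c` of `B(p,3)` expressed by `u`, `v`, `w`,
`A₁`, `A₂`. -/
def bImage (u v w : H) (A₁ A₂ : ℕ → H) (t : Fin 3) (ℓ i : ℕ) : H :=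
  match t with
  | 0 => if ℓ = 1 then A₁ i else u * v * A₂ i
  | 1 => if ℓ = 1 then (if i = 1 then u else u * w⁻¹ * A₁ i * v) else u * w * A₂ i * u⁻¹
  | 2 => if ℓ = 1 then (if i = 1 then u * w * v⁻¹ * u⁻¹ else u * A₁ i * u⁻¹)
      else if i = 1 then 1 else u * w * v * A₂ i * u * w⁻¹ * u⁻¹

theorem map_bImage {K : Type*} [Group K] (f : H →* K) (u v w : H) (A₁ A₂ : ℕ → H)
    (t : Fin 3) (ℓ i : ℕ) :
    f (bImage u v w A₁ A₂ t ℓ i) =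
      bImage (f u) (f v) (f w) (fun i => f (A₁ i)) (fun i => f (A₂ i)) t ℓ i := by
  fin_cases t <;> simp only [bImage] <;> split_ifs <;> simp

/-- The images of the generators `u`, `v`, `w`, `A₁`, `A₂` expressed by `a`, `b`. -/
def gImage (p : ℕ) (a b : ℕ → ℕ → H) : GGen p → H
  | Sum.inl 0 => b 1 1
  | Sum.inl 1 => (b 1 1)⁻¹ * a 2 1
  | Sum.inl 2 => (b 1 1)⁻¹ * b 2 1 * b 1 1
  | Sum.inr ⟨(0, i), _⟩ => a 1 i
  | Sum.inr ⟨(1, i), _⟩ => (a 2 1)⁻¹ * a 2 i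

section LiftB

variable {p ℓ i : ℕ} (f : Fin 3 → ℕ → ℕ → H)

theorem lift_ga (hℓ : 1 ≤ ℓ ∧ ℓ ≤ 2) (hi : 1 ≤ i ∧ i ≤ p - 1) :
    FreeGroup.lift (fun x : BGen p 3 => f x.1.1 x.1.2.1 x.1.2.2) (ga p 3 ℓ i) = f 0 ℓ i := by
  rw [ga, dif_pos ⟨hℓ.1, hℓ.2, hi⟩]
  exact FreeGroup.lift_apply_of

theorem lift_gb (hℓ : 1 ≤ ℓ ∧ ℓ ≤ 2) (hi : 1 ≤ i ∧ i ≤ p - 1) :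
    FreeGroup.lift (fun x : BGen p 3 => f x.1.1 x.1.2.1 x.1.2.2) (gb p 3 ℓ i) = f 1 ℓ i := by
  rw [gb, dif_pos ⟨hℓ.1, hℓ.2, hi⟩]
  exact FreeGroup.lift_apply_of

theorem lift_gc (hℓ : 1 ≤ ℓ ∧ ℓ ≤ 2) (hi : 1 ≤ i ∧ i ≤ p - 1) :
    FreeGroup.lift (fun x : BGen p 3 => f x.1.1 x.1.2.1 x.1.2.2) (gc p 3 ℓ i) = f 2 ℓ i := by
  rw [gc, dif_pos ⟨hℓ.1, hℓ.2, hi⟩]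
  exact FreeGroup.lift_apply_of

end LiftB

section LiftG

variable {p i : ℕ} (a b : ℕ → ℕ → H)

theorem lift_gu : FreeGroup.lift (gImage p a b) (gu p) = b 1 1 := by
  exact FreeGroup.lift_apply_of

theorem lift_gv : FreeGroup.lift (gImage p a b) (gv p) = (b 1 1)⁻¹ * a 2 1 := by
  exact FreeGroup.lift_apply_of

theorem lift_gw : FreeGroup.lift (gImage p a b) (gw p) = (b 1 1)⁻¹ * b 2 1 * b 1 1 := by
  exact FreeGroup.lift_apply_of

theorem lift_gA1 (hi : 2 ≤ i ∧ i ≤ p - 1) :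
    FreeGroup.lift (gImage p a b) (gA1 p i) = a 1 i := by
  rw [gA1, dif_pos hi]
  exact FreeGroup.lift_apply_of

theorem lift_gA2 (hi : 2 ≤ i ∧ i ≤ p - 1) :
    FreeGroup.lift (gImage p a b) (gA2 p i) = (a 2 1)⁻¹ * a 2 i := by
  rw [gA2, dif_pos hi]
  exact FreeGroup.lift_apply_of

end LiftG

/-- The relations (i)–(iv) for elements of a group, with `A₁ 1 = A₂ 1 = 1`. -/
structure GRelations (p : ℕ) (u v w : H) (A₁ A₂ : ℕ → H) : Prop where
  one₁ : A₁ 1 = 1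
  one₂ : A₂ 1 = 1
  comm₁₁ : ∀ i j, 2 ≤ i → i < j → j ≤ p - 1 → w⁻¹ * A₁ i * v * A₁ j = A₁ j * (w⁻¹ * A₁ i * v)
  comm₁₂ : ∀ i j, 2 ≤ i → i ≤ p - 2 → 2 ≤ j → j ≤ p - i →
    w⁻¹ * A₁ i * v * A₂ j = A₂ j * (w⁻¹ * A₁ i * v)
  comm₂₂ : ∀ i j, 2 ≤ i → i < j → j ≤ p - 1 → v * A₂ j * u * A₂ i = A₂ i * (v * A₂ j * u)
  comm₂₁ : ∀ i j, 3 ≤ i → i ≤ p - 1 → 3 ≤ j → j ≤ p - 1 → p + 2 ≤ i + j →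
    v * A₂ j * u * A₁ i = A₁ i * (v * A₂ j * u)

/-- The relations (R1)–(R4) of `B(p,3)` for elements of a group. -/
structure BRelations (p : ℕ) (a b c : ℕ → ℕ → H) : Prop where
  a_one : a 1 1 = 1
  c_one : c 2 1 = 1
  conj : ∀ ℓ i j, 1 ≤ ℓ → ℓ ≤ 2 → 1 ≤ i → i < j → j ≤ p - 1 → b ℓ i * a ℓ j = c ℓ j * b ℓ i
  square : ∀ i j, 1 ≤ i → i ≤ p - 1 → 1 ≤ j → j ≤ p - i → c 1 i * a 2 j = b 2 j * b 1 i
  comm : ∀ i j, 3 ≤ i → i ≤ p - 1 → 3 ≤ j → j ≤ p - 1 → p + 2 ≤ i + j →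
    c 1 i * a 2 j = a 2 j * c 1 i

theorem GRelations.lift_eq_one {p : ℕ} (hp : 3 ≤ p) {u v w : H} {A₁ A₂ : ℕ → H}
    (h : GRelations p u v w A₁ A₂) :
    ∀ r ∈ Brels p 3,
      FreeGroup.lift (fun x : BGen p 3 => bImage u v w A₁ A₂ x.1.1 x.1.2.1 x.1.2.2) r = 1 := by
  rintro r (rfl | rfl | ⟨ℓ, i, j, hℓ, hℓ', hi, hij, hj, rfl⟩ |
    ⟨ℓ, i, j, hℓ, hℓ', hi, hi', hj, hj', rfl⟩ |
    ⟨ℓ, i, j, hℓ, hℓ', hi, hi', hj, hj', hij, rfl⟩ | ⟨ℓ, lam, i, j, hℓ, hlam, hlam', -⟩)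
  · rw [lift_ga _ (by omega) (by omega)]
    simp [bImage, h.one₁]
  · rw [lift_gc _ (by omega) (by omega)]
    simp [bImage]
  · simp only [map_mul, map_inv]
    rw [lift_ga _ (by omega) (by omega), lift_gb _ (by omega) (by omega),
      lift_gc _ (by omega) (by omega), mul_inv_eq_one, mul_inv_eq_iff_eq_mul]
    have hj1 : j ≠ 1 := by omega
    obtain rfl | rfl : ℓ = 1 ∨ ℓ = 2 := by omega
    · by_cases hi1 : i = 1
      · simp [bImage, hi1, hj1]
      · simpa [bImage, hi1, hj1, mul_assoc] using h.comm₁₁ i j (by omega) hij hj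
    · by_cases hi1 : i = 1
      · simp [bImage, hi1, hj1, h.one₂, mul_assoc]
      · have := congrArg (· * u⁻¹) (h.comm₂₂ i j (by omega) hij hj).symm
        simpa [bImage, hj1, mul_assoc] using this
  · obtain rfl : ℓ = 1 := by omega
    simp only [map_mul, map_inv]
    rw [lift_ga _ (by omega) (by omega), lift_gb _ (by omega) (by omega),
      lift_gc _ (by omega) (by omega), lift_gb _ (by omega) (by omega), mul_inv_eq_one,
      mul_inv_eq_iff_eq_mul]
    by_cases hi1 : i = 1
    · simp [bImage, hi1, mul_assoc]
    · by_cases hj1 : j = 1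
      · simp [bImage, hi1, hj1, h.one₂, mul_assoc]
      · have := h.comm₁₂ i j (by omega) (by omega) (by omega) hj'
        rw [mul_assoc, mul_assoc, mul_assoc, inv_mul_eq_iff_eq_mul] at this
        simpa [bImage, hi1, mul_assoc] using this
  · obtain rfl : ℓ = 1 := by omega
    rw [map_gcomm, lift_ga _ (by omega) (by omega), lift_gc _ (by omega) (by omega),
      gcomm_eq_one_iff]
    have := h.comm₂₁ i j hi hi' hj hj' hij
    have hi1 : i ≠ 1 := by omega
    have key : A₁ i * (v * A₂ j) = v * A₂ j * u * A₁ i * u⁻¹ := by rw [this]; group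
    simpa [bImage, hi1, mul_assoc] using key
  · omega

theorem BRelations.square_one {p : ℕ} (hp : 3 ≤ p) {a b c : ℕ → ℕ → H}
    (h : BRelations p a b c) {i : ℕ} (hi : 1 ≤ i) (hi' : i ≤ p - 1) :
    b 1 i = (b 2 1)⁻¹ * c 1 i * a 2 1 := by
  rw [mul_assoc, h.square i 1 hi hi' le_rfl (by omega), inv_mul_cancel_left]

theorem BRelations.c_eq {p : ℕ} {a b c : ℕ → ℕ → H}
    (h : BRelations p a b c) {ℓ i : ℕ} (hℓ : 1 ≤ ℓ) (hℓ' : ℓ ≤ 2) (hi : 2 ≤ i) (hi' : i ≤ p - 1) :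
    c ℓ i = b ℓ 1 * a ℓ i * (b ℓ 1)⁻¹ := by
  rw [h.conj ℓ 1 i hℓ hℓ' le_rfl (by omega) hi', mul_inv_cancel_right]

theorem BRelations.c_one_one {p : ℕ} (hp : 3 ≤ p) {a b c : ℕ → ℕ → H}
    (h : BRelations p a b c) : c 1 1 = b 2 1 * b 1 1 * (a 2 1)⁻¹ := by
  rw [← h.square 1 1 le_rfl (by omega) le_rfl (by omega), mul_inv_cancel_right]

theorem BRelations.b_two {p : ℕ} (hp : 3 ≤ p) {a b c : ℕ → ℕ → H}
    (h : BRelations p a b c) {j : ℕ} (hj : 1 ≤ j) (hj' : j ≤ p - 1) :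
    b 2 j = b 2 1 * b 1 1 * (a 2 1)⁻¹ * a 2 j * (b 1 1)⁻¹ := by
  rw [← h.c_one_one hp, h.square 1 j le_rfl (by omega) hj (by omega), mul_inv_cancel_right]

theorem BRelations.b_one {p : ℕ} (hp : 3 ≤ p) {a b c : ℕ → ℕ → H}
    (h : BRelations p a b c) {i : ℕ} (hi : 2 ≤ i) (hi' : i ≤ p - 1) :
    b 1 i = (b 2 1)⁻¹ * (b 1 1 * a 1 i * (b 1 1)⁻¹) * a 2 1 := by
  rw [h.square_one hp (by omega) hi', h.c_eq le_rfl (by omega) hi hi']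

theorem BRelations.lift_eq_one {p : ℕ} (hp : 3 ≤ p) {a b c : ℕ → ℕ → H}
    (h : BRelations p a b c) : ∀ r ∈ Grels p, FreeGroup.lift (gImage p a b) r = 1 := by
  rintro r (⟨i, j, hi, hij, hj, rfl⟩ | ⟨i, j, hi, hi', hj, hj', rfl⟩ |
    ⟨i, j, hi, hij, hj, rfl⟩ | ⟨i, j, hi, hi', hj, hj', hij, rfl⟩) <;>
  simp only [map_gcomm, map_mul, map_inv, lift_gu, lift_gv, lift_gw, gcomm_eq_one_iff]
  · rw [lift_gA1 _ _ (by omega), lift_gA1 _ _ (by omega)]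
    have key := h.conj 1 i j le_rfl (by omega) (by omega) hij hj
    rw [h.c_eq le_rfl (by omega) (by omega) hj, h.b_one hp hi (by omega)] at key
    have := congrArg ((b 1 1)⁻¹ * ·) key
    simpa [mul_assoc] using this
  · rw [lift_gA1 _ _ (by omega), lift_gA2 _ _ (by omega)]
    have key := h.square i j (by omega) (by omega) (by omega) hj'
    rw [h.c_eq le_rfl (by omega) (by omega) (by omega), h.b_one hp hi (by omega),
      h.b_two hp (by omega) (by omega)] at key
    have := congrArg ((b 1 1)⁻¹ * (b 2 1)⁻¹ * ·) key
    simpa [mul_assoc] using this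
  · rw [lift_gA2 _ _ (by omega), lift_gA2 _ _ (by omega)]
    have key := h.conj 2 i j (by omega) le_rfl (by omega) hij hj
    rw [h.c_eq (by omega) le_rfl (by omega) hj, h.b_two hp (by omega) (by omega)] at key
    have := congrArg (fun x => (b 1 1)⁻¹ * (b 2 1)⁻¹ * x * b 1 1) key
    simpa [mul_assoc] using this.symm
  · rw [lift_gA1 _ _ (by omega), lift_gA2 _ _ (by omega)]
    have key := h.comm i j hi hi' hj hj' hij
    rw [h.c_eq le_rfl (by omega) (by omega) hi'] at key
    have := congrArg (fun x => (b 1 1)⁻¹ * x * b 1 1) key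
    simpa [mul_assoc] using this.symm

theorem BRelations.bImage_eq {p : ℕ} (hp : 3 ≤ p) {a b c : ℕ → ℕ → H}
    (h : BRelations p a b c) {A₁ A₂ : ℕ → H}
    (hA₁ : ∀ i, 1 ≤ i → i ≤ p - 1 → A₁ i = a 1 i)
    (hA₂ : ∀ i, 1 ≤ i → i ≤ p - 1 → A₂ i = (a 2 1)⁻¹ * a 2 i)
    (t : Fin 3) {ℓ i : ℕ} (hℓ : 1 ≤ ℓ) (hℓ' : ℓ ≤ 2) (hi : 1 ≤ i) (hi' : i ≤ p - 1) :
    bImage (b 1 1) ((b 1 1)⁻¹ * a 2 1) ((b 1 1)⁻¹ * b 2 1 * b 1 1) A₁ A₂ t ℓ i =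
      ![a, b, c] t ℓ i := by
  have hA₁i := hA₁ i hi hi'
  have hA₂i := hA₂ i hi hi'
  have hℓ₁₂ : ℓ = 1 ∨ ℓ = 2 := by omega
  obtain rfl | hi₂ : i = 1 ∨ 2 ≤ i := by omega
  · rcases hℓ₁₂ with rfl | rfl <;> fin_cases t <;>
      simp [bImage, hA₁i, hA₂i, h.c_one, h.c_one_one hp, mul_assoc]
  · have hi₁ : i ≠ 1 := by omega
    rcases hℓ₁₂ with rfl | rfl <;> fin_cases t
    · simp [bImage, hA₁i]
    · simp [bImage, hi₁, hA₁i, h.b_one hp hi₂ hi', mul_assoc]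
    · simp [bImage, hi₁, hA₁i, h.c_eq le_rfl hℓ' hi₂ hi', mul_assoc]
    · simp [bImage, hA₂i]
    · simp [bImage, hA₂i, h.b_two hp hi hi', mul_assoc]
    · simp [bImage, hi₁, hA₂i, h.c_eq hℓ le_rfl hi₂ hi', mul_assoc]

end CommutatorPresentation

section Isomorphism

variable (p : ℕ)

theorem BRelations.presented :
    BRelations p (fun ℓ i => PresentedGroup.mk (Brels p 3) (ga p 3 ℓ i))
      (fun ℓ i => PresentedGroup.mk (Brels p 3) (gb p 3 ℓ i))
      (fun ℓ i => PresentedGroup.mk (Brels p 3) (gc p 3 ℓ i)) where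
  a_one := PresentedGroup.one_of_mem (Or.inl rfl)
  c_one := PresentedGroup.one_of_mem (Or.inr (Or.inl rfl))
  conj ℓ i j hℓ hℓ' hi hij hj := by
    rw [← mul_inv_eq_iff_eq_mul, ← mul_inv_eq_one]
    simp only [← map_mul, ← map_inv]
    exact PresentedGroup.one_of_mem
      (Or.inr (Or.inr (Or.inl ⟨ℓ, i, j, hℓ, hℓ', hi, hij, hj, rfl⟩)))
  square i j hi hi' hj hj' := by
    rw [← mul_inv_eq_iff_eq_mul, ← mul_inv_eq_one]
    simp only [← map_mul, ← map_inv]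
    exact PresentedGroup.one_of_mem
      (Or.inr (Or.inr (Or.inr (Or.inl ⟨1, i, j, le_rfl, le_rfl, hi, hi', hj, hj', rfl⟩))))
  comm i j hi hi' hj hj' hij := by
    rw [← gcomm_eq_one_iff, ← map_gcomm]
    exact PresentedGroup.one_of_mem (Or.inr (Or.inr (Or.inr (Or.inr (Or.inl
      ⟨1, i, j, le_rfl, le_rfl, hi, hi', hj, hj', hij, rfl⟩)))))

theorem GRelations.presented :
    GRelations p (PresentedGroup.mk (Grels p) (gu p)) (PresentedGroup.mk (Grels p) (gv p))
      (PresentedGroup.mk (Grels p) (gw p)) (fun i => PresentedGroup.mk (Grels p) (gA1 p i))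
      (fun i => PresentedGroup.mk (Grels p) (gA2 p i)) where
  one₁ := by simp [gA1]
  one₂ := by simp [gA2]
  comm₁₁ i j hi hij hj := by
    rw [← gcomm_eq_one_iff]
    simp only [← map_inv, ← map_mul, ← map_gcomm]
    exact PresentedGroup.one_of_mem (Or.inl ⟨i, j, hi, hij, hj, rfl⟩)
  comm₁₂ i j hi hi' hj hj' := by
    rw [← gcomm_eq_one_iff]
    simp only [← map_inv, ← map_mul, ← map_gcomm]
    exact PresentedGroup.one_of_mem (Or.inr (Or.inl ⟨i, j, hi, hi', hj, hj', rfl⟩))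
  comm₂₂ i j hi hij hj := by
    rw [← gcomm_eq_one_iff]
    simp only [← map_mul, ← map_gcomm]
    exact PresentedGroup.one_of_mem (Or.inr (Or.inr (Or.inl ⟨i, j, hi, hij, hj, rfl⟩)))
  comm₂₁ i j hi hi' hj hj' hij := by
    rw [← gcomm_eq_one_iff]
    simp only [← map_mul, ← map_gcomm]
    exact PresentedGroup.one_of_mem (Or.inr (Or.inr (Or.inr ⟨i, j, hi, hi', hj, hj', hij, rfl⟩)))

variable {p}

/-- The homomorphism from `B(p,3)` to the group with the four-family commutator presentation. -/
def bToG (hp : 3 ≤ p) : B p 3 →* PresentedGroup (Grels p) :=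
  PresentedGroup.toGroup ((GRelations.presented p).lift_eq_one hp)

/-- The homomorphism to `B(p,3)` from the group with the four-family commutator presentation. -/
def gToB (hp : 3 ≤ p) : PresentedGroup (Grels p) →* B p 3 :=
  PresentedGroup.toGroup ((BRelations.presented p).lift_eq_one hp)

theorem gToB_comp_bToG (hp : 3 ≤ p) : (gToB hp).comp (bToG hp) = MonoidHom.id _ := by
  have hB := BRelations.presented p
  refine PresentedGroup.ext fun ⟨⟨t, ℓ, i⟩, hℓ, hℓ', hi, hi'⟩ => ?_
  refine (congrArg (gToB hp) (PresentedGroup.toGroup.of _)).trans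
    ((map_bImage (gToB hp) _ _ _ _ _ t ℓ i).trans ?_)
  have hu : gToB hp (PresentedGroup.mk _ (gu p)) = _ := lift_gu _ _
  have hv : gToB hp (PresentedGroup.mk _ (gv p)) = _ := lift_gv _ _
  have hw : gToB hp (PresentedGroup.mk _ (gw p)) = _ := lift_gw _ _
  rw [hu, hv, hw, hB.bImage_eq hp _ _ t hℓ hℓ' hi hi']
  · have hx : 1 ≤ ℓ ∧ ℓ ≤ 3 - 1 ∧ 1 ≤ i ∧ i ≤ p - 1 := ⟨hℓ, hℓ', hi, hi'⟩
    fin_cases t <;> simp [ga, gb, gc, dif_pos hx] <;> rfl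
  · intro i hi hi'
    obtain rfl | hi₂ : i = 1 ∨ 2 ≤ i := by omega
    · simpa [gA1] using hB.a_one.symm
    · exact lift_gA1 _ _ ⟨hi₂, hi'⟩
  · intro i hi hi'
    obtain rfl | hi₂ : i = 1 ∨ 2 ≤ i := by omega
    · simp [gA2]
    · exact lift_gA2 _ _ ⟨hi₂, hi'⟩

theorem bToG_comp_gToB (hp : 3 ≤ p) : (bToG hp).comp (gToB hp) = MonoidHom.id _ := by
  have ha : ∀ ℓ i, (1 ≤ ℓ ∧ ℓ ≤ 2) → (1 ≤ i ∧ i ≤ p - 1) →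
      bToG hp (PresentedGroup.mk _ (ga p 3 ℓ i)) = _ := fun ℓ i hℓ hi => lift_ga _ hℓ hi
  have hb : ∀ ℓ i, (1 ≤ ℓ ∧ ℓ ≤ 2) → (1 ≤ i ∧ i ≤ p - 1) →
      bToG hp (PresentedGroup.mk _ (gb p 3 ℓ i)) = _ := fun ℓ i hℓ hi => lift_gb _ hℓ hi
  have ha₂ := ha 2 1 (by omega) (by omega)
  have hb₁ := hb 1 1 (by omega) (by omega)
  have hb₂ := hb 2 1 (by omega) (by omega)
  refine PresentedGroup.ext fun x => ?_
  rw [MonoidHom.comp_apply, gToB, PresentedGroup.toGroup.of]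
  match x with
  | Sum.inl 0 =>
    simp only [gImage, hb₁]
    simp [bImage]
    rfl
  | Sum.inl 1 =>
    simp only [gImage, map_mul, map_inv, hb₁, ha₂]
    simp [bImage, gA2]
    rfl
  | Sum.inl 2 =>
    simp only [gImage, map_mul, map_inv, hb₁, hb₂]
    simp [bImage, gA2, mul_assoc]
    rfl
  | Sum.inr ⟨(0, i), hi⟩ =>
    simp only [gImage]
    rw [ha 1 i (by omega) ⟨by omega, hi.2⟩]
    simp [bImage, gA1, dif_pos hi]
    rfl
  | Sum.inr ⟨(1, i), hi⟩ =>
    simp only [gImage, map_mul, map_inv, ha₂]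
    rw [ha 2 i (by omega) ⟨by omega, hi.2⟩]
    simp [bImage, gA2, dif_pos hi, mul_assoc]
    rfl

end Isomorphism

/-- **Theorem (four-family commutator presentation of `B(p,3)`).**
For every integer `p ≥ 3`, `B(p,3)` is isomorphic to the group presented by generators
`u, v, w` and `A_{1,i}, A_{2,i}` for `2 ≤ i ≤ p-1` with relators (i)–(iv). -/
theorem B_p3_iso_G_presentation (p : ℕ) (hp : 3 ≤ p) :
    Nonempty (B p 3 ≃* PresentedGroup (Grels p)) := by
  exact ⟨(bToG hp).toMulEquiv (gToB hp) (gToB_comp_bToG hp) (bToG_comp_gToB hp)⟩
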